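/- For every fixed positive integer m, α(m,n) = Θ( α(m,1)ⁿ / n^{⌊(m-1)/2⌋ + 1/2} ) as n → ∞; that is, there exist constants c, C > 0 and N, depending only on m, such that for all n ≥ N, c · α(m,1)ⁿ / n^{⌊(m-1)/2⌋ + 1/2} ≤ α(m,n) ≤ C · α(m,1)ⁿ / n^{⌊(m-1)/2⌋ + 1/2}, where α(m,1) = C(2⌊(m+1)/2⌋, ⌊(m+1)/2⌋) and C(a,b) denotes the binomial coefficient. -/

import Mathlib

open Finset

/-- A ±1 matrix: every entry is 1 or -1. -/
def IsPM {m n : ℕ} (M : Matrix (Fin m) (Fin n) ℤ) : Prop :=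
  ∀ i j, M i j = 1 ∨ M i j = -1

/-- `goodA m n` is the set A(m,n) of m×n ±1 matrices all of whose row sums and
column sums have absolute value at most 1. -/
def goodA (m n : ℕ) : Set (Matrix (Fin m) (Fin n) ℤ) :=
  {M | IsPM M ∧ (∀ i, |∑ j, M i j| ≤ 1) ∧ (∀ j, |∑ i, M i j| ≤ 1)}

/-- `alpha m n = |A(m,n)|`. -/
noncomputable def alpha (m n : ℕ) : ℕ := (goodA m n).ncard

/-- The sum of `f (w + k₁ + ⋯ + kₙ)` over all `n`-step walks with steps `kⱼ ∈ K`. -/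
def walkSum {ι : Type*} (K : Finset (ι → ℤ)) (n : ℕ) (f : (ι → ℤ) → ℝ) (w : ι → ℤ) : ℝ :=
  ∑ x : Fin n → K, f (w + ∑ j, (x j : ι → ℤ))

section Walk

variable {ι : Type*} {K : Finset (ι → ℤ)}

theorem walkSum_zero (f : (ι → ℤ) → ℝ) (w : ι → ℤ) : walkSum K 0 f w = f w := by
  simp [walkSum]

theorem walkSum_succ (n : ℕ) (f : (ι → ℤ) → ℝ) (w : ι → ℤ) :
    walkSum K (n + 1) f w = ∑ k ∈ K, walkSum K n f (w + k) := by
  unfold walkSum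
  rw [← (Fin.consEquiv fun _ => K).sum_comp, Fintype.sum_prod_type, ← Finset.sum_coe_sort K]
  simp [Fin.consEquiv, Fin.sum_univ_succ, add_assoc]

theorem walkSum_shift (n : ℕ) (f : (ι → ℤ) → ℝ) (u w : ι → ℤ) :
    walkSum K n (fun y => f (y + u)) w = walkSum K n f (w + u) := by
  simp only [walkSum, add_right_comm]

theorem walkSum_add_fun (n : ℕ) (f g : (ι → ℤ) → ℝ) (w : ι → ℤ) :
    walkSum K n (fun y => f y + g y) w = walkSum K n f w + walkSum K n g w :=
  Finset.sum_add_distrib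

theorem walkSum_mul_left (n : ℕ) (c : ℝ) (f : (ι → ℤ) → ℝ) (w : ι → ℤ) :
    walkSum K n (fun y => c * f y) w = c * walkSum K n f w :=
  (Finset.mul_sum _ _ _).symm

theorem walkSum_sum {α : Type*} (s : Finset α) (n : ℕ) (f : α → (ι → ℤ) → ℝ) (w : ι → ℤ) :
    walkSum K n (fun y => ∑ a ∈ s, f a y) w = ∑ a ∈ s, walkSum K n (f a) w :=
  Finset.sum_comm

theorem walkSum_const (n : ℕ) (c : ℝ) (w : ι → ℤ) :
    walkSum K n (fun _ => c) w = (#K : ℝ) ^ n * c := by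
  simp [walkSum]

theorem walkSum_mono (n : ℕ) {f g : (ι → ℤ) → ℝ} (h : ∀ y, f y ≤ g y) (w : ι → ℤ) :
    walkSum K n f w ≤ walkSum K n g w :=
  Finset.sum_le_sum fun _ _ => h _

theorem walkSum_succ' (n : ℕ) (f : (ι → ℤ) → ℝ) (w : ι → ℤ) :
    walkSum K (n + 1) f w = walkSum K n (fun y => ∑ k ∈ K, f (y + k)) w := by
  rw [walkSum_succ, walkSum_sum]
  simp only [walkSum_shift]

theorem walkSum_add (a b : ℕ) (f : (ι → ℤ) → ℝ) (w : ι → ℤ) :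
    walkSum K (a + b) f w = walkSum K a (walkSum K b f) w := by
  induction a generalizing w with
  | zero => rw [walkSum_zero, zero_add]
  | succ a ih => rw [add_right_comm, walkSum_succ, walkSum_succ]; simp only [ih]

theorem walkSum_neg (hK : ∀ k ∈ K, -k ∈ K) (n : ℕ) (f : (ι → ℤ) → ℝ) (w : ι → ℤ) :
    walkSum K n (fun y => f (-y)) w = walkSum K n f (-w) := by
  induction n generalizing w with
  | zero => simp [walkSum_zero]
  | succ n ih =>
    rw [walkSum_succ, walkSum_succ]
    refine Finset.sum_nbij' (fun k => -k) (fun k => -k) hK hK (by simp) (by simp) fun k _ => ?_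
    rw [ih, neg_add]

end Walk

/-- The number of `j`-step simple walks on `ℤ` from `0` to `z`. -/
def latticePaths (j : ℕ) (z : ℤ) : ℕ :=
  if 0 ≤ j + z ∧ (j + z) % 2 = 0 then j.choose ((j + z) / 2).toNat else 0

theorem latticePaths_succ (j : ℕ) (z : ℤ) :
    latticePaths (j + 1) z = latticePaths j (z + 1) + latticePaths j (z - 1) := by
  unfold latticePaths
  by_cases h : ((j : ℤ) + 1 + z) % 2 = 0
  · by_cases h0 : 0 ≤ (j : ℤ) + 1 + z
    · obtain ⟨i, hi⟩ : ∃ i : ℕ, (j : ℤ) + 1 + z = 2 * i :=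
        ⟨(((j : ℤ) + 1 + z) / 2).toNat, by omega⟩
      obtain rfl : z = 2 * i - j - 1 := by omega
      rcases i with _ | i
      · rw [if_pos (by constructor <;> push_cast <;> omega),
          if_pos (by constructor <;> push_cast <;> omega), if_neg (by push_cast; omega)]
        rw [show (((j + 1 : ℕ) : ℤ) + (2 * ((0 : ℕ) : ℤ) - j - 1)) / 2 = 0 by push_cast; omega,
          show ((j : ℤ) + (2 * ((0 : ℕ) : ℤ) - j - 1 + 1)) / 2 = 0 by push_cast; omega]
        simp
      · rw [if_pos (by constructor <;> push_cast <;> omega),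
          if_pos (by constructor <;> push_cast <;> omega),
          if_pos (by constructor <;> push_cast <;> omega)]
        rw [show ((((j + 1 : ℕ) : ℤ) + (2 * ((i + 1 : ℕ) : ℤ) - j - 1)) / 2).toNat = i + 1 by
            push_cast; omega,
          show (((j : ℤ) + (2 * ((i + 1 : ℕ) : ℤ) - j - 1 + 1)) / 2).toNat = i + 1 by
            push_cast; omega,
          show (((j : ℤ) + (2 * ((i + 1 : ℕ) : ℤ) - j - 1 - 1)) / 2).toNat = i by
            push_cast; omega, Nat.choose_succ_succ, add_comm]
    · rw [if_neg (by push_cast; omega), if_neg (by omega), if_neg (by omega)]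
  · rw [if_neg (by push_cast; omega), if_neg (by omega), if_neg (by omega)]

theorem centralBinom_sq_mul_le (k : ℕ) : k.centralBinom ^ 2 * (2 * k + 1) ≤ 16 ^ k := by
  induction k with
  | zero => simp
  | succ k ih =>
    have h := Nat.succ_mul_centralBinom_succ k
    refine Nat.le_of_mul_le_mul_left (c := (k + 1) ^ 2) ?_ (by positivity)
    calc (k + 1) ^ 2 * ((k + 1).centralBinom ^ 2 * (2 * (k + 1) + 1))
        = ((k + 1) * (k + 1).centralBinom) ^ 2 * (2 * (k + 1) + 1) := by ring
      _ = (k.centralBinom ^ 2 * (2 * k + 1)) * (4 * ((2 * k + 1) * (2 * k + 3))) := by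
        rw [h]; ring
      _ ≤ 16 ^ k * (4 * (4 * (k + 1) ^ 2)) := Nat.mul_le_mul ih (by nlinarith)
      _ = (k + 1) ^ 2 * 16 ^ (k + 1) := by ring

theorem choose_half_sq_mul_le (j : ℕ) : (j.choose (j / 2)) ^ 2 * (j + 1) ≤ 4 ^ j := by
  obtain ⟨k, rfl | rfl⟩ := j.even_or_odd'
  · have := centralBinom_sq_mul_le k
    rw [Nat.centralBinom] at this
    simpa [pow_mul] using this
  · have h := centralBinom_sq_mul_le (k + 1)
    have e : (k + 1).centralBinom = 2 * (2 * k + 1).choose k := by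
      rw [Nat.centralBinom, mul_add, mul_one, Nat.choose_succ_succ, ← Nat.choose_symm_half]
      ring
    rw [e] at h
    rw [show (2 * k + 1) / 2 = k by omega]
    have : (16 : ℕ) ^ (k + 1) = 4 * 4 ^ (2 * k + 1) := by
      rw [show (16 : ℕ) = 4 ^ 2 by norm_num, ← pow_mul, ← pow_succ']; congr 1
    rw [this] at h
    nlinarith [sq_nonneg ((2 * k + 1).choose k)]

theorem latticePaths_le (j : ℕ) (z : ℤ) :
    (latticePaths j z : ℝ) ≤ 2 ^ j / √(j + 1 : ℝ) := by
  have h1 : latticePaths j z ≤ j.choose (j / 2) := by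
    unfold latticePaths
    split_ifs
    · exact Nat.choose_le_middle _ _
    · exact Nat.zero_le _
  have h2 : ((j.choose (j / 2) : ℝ)) ^ 2 * (j + 1) ≤ 4 ^ j := by
    exact_mod_cast choose_half_sq_mul_le j
  refine (Nat.cast_le.mpr h1).trans ?_
  rw [le_div_iff₀ (by positivity)]
  refine (pow_le_pow_iff_left₀ (by positivity) (by positivity) two_ne_zero).mp ?_
  rw [mul_pow, Real.sq_sqrt (by positivity), ← pow_mul, mul_comm j, pow_mul]
  norm_num
  exact h2

theorem inv_sqrt_average_le {x κ : ℝ} (hx : 1 ≤ x) (hκ : 2 ≤ κ) :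
    (κ - 2) / √x + 2 / √(x + 1) ≤ κ / √(x + 1 / κ) := by
  have hx0 : 0 < x := by linarith
  have hκ0 : 0 < κ := by linarith
  have hs : 0 < √x := Real.sqrt_pos.mpr hx0
  have h1 : 1 / √(x + 1) ≤ (1 - 1 / (4 * x)) / √x := by
    have hy : 0 < 1 - 1 / (4 * x) := by
      rw [sub_pos, div_lt_one (by positivity)]; linarith
    rw [div_le_div_iff₀ (by positivity) hs, one_mul]
    apply Real.sqrt_le_iff.mpr ⟨by positivity, ?_⟩
    rw [mul_pow, Real.sq_sqrt (by positivity)]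
    rw [show (1 - 1 / (4 * x)) ^ 2 * (x + 1)
      = x + (8 * x ^ 2 - 7 * x + 1) / (16 * x ^ 2) by field_simp; ring]
    have : 0 ≤ (8 * x ^ 2 - 7 * x + 1) / (16 * x ^ 2) := by
      apply div_nonneg <;> nlinarith
    linarith
  have h2 : (1 - 1 / (2 * κ * x)) / √x ≤ 1 / √(x + 1 / κ) := by
    rw [div_le_div_iff₀ hs (by positivity), one_mul]
    refine Real.le_sqrt_of_sq_le ?_
    rw [mul_pow, Real.sq_sqrt (by positivity)]
    have hz : 0 < 1 / (κ * x) := by positivity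
    have hz1 : 1 / (κ * x) ≤ 1 := by
      rw [div_le_one (by positivity)]; nlinarith
    have e1 : 1 / (2 * κ * x) = 1 / (κ * x) / 2 := by field_simp
    have e2 : x + 1 / κ = x * (1 + 1 / (κ * x)) := by field_simp
    rw [e1, e2]
    generalize 1 / (κ * x) = z at *
    nlinarith [mul_pos hx0 (mul_pos hz hz), mul_nonneg hx0.le (mul_nonneg (mul_pos hz hz).le (by linarith : 0 ≤ 3 - z))]
  calc (κ - 2) / √x + 2 / √(x + 1) = (κ - 2) / √x + 2 * (1 / √(x + 1)) := by ring
    _ ≤ (κ - 2) / √x + 2 * ((1 - 1 / (4 * x)) / √x) := by gcongr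
    _ = κ * ((1 - 1 / (2 * κ * x)) / √x) := by field_simp; ring
    _ ≤ κ * (1 / √(x + 1 / κ)) := by gcongr
    _ = κ / √(x + 1 / κ) := by ring

section Concentration

variable {ι : Type*} [Fintype ι] [DecidableEq ι] {K : Finset (ι → ℤ)}

theorem walkSum_mul_latticePaths_le {t : ι} {k₀ : ι → ℤ}
    (h1 : Function.update k₀ t 1 ∈ K) (h2 : Function.update k₀ t (-1) ∈ K)
    {ψ : (ι → ℤ) → ℝ} (hψ0 : ∀ w, 0 ≤ ψ w) (hψ : ∀ w z, ψ (Function.update w t z) = ψ w)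
    {n : ℕ} {R : ℝ} (hR : ∀ w, walkSum K n ψ w ≤ R) (a : ℤ) (q j : ℕ) (w : ι → ℤ) :
    walkSum K (n + q) (fun y => ψ y * latticePaths j (y t - a)) w ≤
      R * (#K : ℝ) ^ q * 2 ^ j / √(j + 1 + q / #K : ℝ) := by
  have hR0 : 0 ≤ R := le_trans (Finset.sum_nonneg fun _ _ => hψ0 _) (hR w)
  have hne : Function.update k₀ t 1 ≠ Function.update k₀ t (-1) := fun h => by
    simpa using congrFun h t
  have hcard : 2 ≤ #K := by
    rw [← Finset.card_pair hne]
    exact Finset.card_le_card (by simp [Finset.insert_subset_iff, h1, h2])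
  induction q generalizing j w with
  | zero =>
    calc walkSum K (n + 0) (fun y => ψ y * latticePaths j (y t - a)) w
        ≤ walkSum K n (fun y => 2 ^ j / √(j + 1 : ℝ) * ψ y) w := by
          refine walkSum_mono _ (fun y => ?_) w
          rw [mul_comm]
          exact mul_le_mul_of_nonneg_right (latticePaths_le _ _) (hψ0 y)
      _ ≤ 2 ^ j / √(j + 1 : ℝ) * R := by
          rw [walkSum_mul_left]
          exact mul_le_mul_of_nonneg_left (hR w) (by positivity)
      _ = _ := by simp; ring
  | succ q ih =>
    set κ : ℝ := (#K : ℝ) with hκ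
    have hκ2 : 2 ≤ κ := by rw [hκ]; exact_mod_cast hcard
    have hpair : ({Function.update k₀ t 1, Function.update k₀ t (-1)} : Finset (ι → ℤ)) ⊆ K := by
      simp [Finset.insert_subset_iff, h1, h2]
    have hflip : walkSum K (n + q) (fun y => ψ y * latticePaths j (y t - a))
          (w + Function.update k₀ t 1) +
        walkSum K (n + q) (fun y => ψ y * latticePaths j (y t - a))
          (w + Function.update k₀ t (-1)) =
        walkSum K (n + q) (fun y => ψ y * latticePaths (j + 1) (y t - a))
          (w + Function.update k₀ t 0) := by
      rw [← walkSum_shift, ← walkSum_shift _ _ (Function.update k₀ t (-1)), ← walkSum_add_fun,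
        ← walkSum_shift _ _ (Function.update k₀ t 0)]
      congr 1
      funext y
      have e : ∀ z, ψ (y + Function.update k₀ t z) = ψ (y + k₀) := fun z => by
        rw [← hψ (y + k₀) (y t + z)]
        congr 1
        ext i
        rcases eq_or_ne i t with rfl | hi <;> simp [*]
      simp only [e, latticePaths_succ, Pi.add_apply, Function.update_self, Nat.cast_add]
      rw [show y t + 1 - a = y t + 0 - a + 1 by ring, show y t + -1 - a = y t + 0 - a - 1 by ring]
      ring
    set x : ℝ := j + 1 + q / κ with hx
    have hx1 : 1 ≤ x := by
      have : 0 ≤ (q : ℝ) / κ := by positivity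
      have : (0 : ℝ) ≤ j := by positivity
      linarith
    have hM : (#(K \ {Function.update k₀ t 1, Function.update k₀ t (-1)}) : ℝ) = κ - 2 := by
      rw [Finset.card_sdiff_of_subset hpair, Finset.card_pair hne, Nat.cast_sub hcard]
      rfl
    rw [← add_assoc, walkSum_succ, ← Finset.sum_sdiff hpair, Finset.sum_pair hne, hflip]
    calc _ ≤ ∑ k ∈ K \ {Function.update k₀ t 1, Function.update k₀ t (-1)},
            (R * κ ^ q * 2 ^ j / √x) + R * κ ^ q * 2 ^ (j + 1) / √(x + 1) := by
          refine add_le_add (Finset.sum_le_sum fun k _ => ih j _) ((ih (j + 1) _).trans_eq ?_)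
          rw [hx]; push_cast; ring_nf
      _ = R * κ ^ q * 2 ^ j * ((κ - 2) / √x + 2 / √(x + 1)) := by
          rw [Finset.sum_const, nsmul_eq_mul, hM]; ring
      _ ≤ R * κ ^ q * 2 ^ j * (κ / √(x + 1 / κ)) := by
          gcongr
          exact inv_sqrt_average_le hx1 hκ2
      _ = _ := by
          rw [hx]; push_cast; ring_nf

theorem walkSum_indicator_le
    (hK : ∀ t, ∃ k₀ : ι → ℤ, Function.update k₀ t 1 ∈ K ∧ Function.update k₀ t (-1) ∈ K)
    (q r : ℕ) (v : ι → ℤ) (S : Finset ι) (w : ι → ℤ) :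
    walkSum K (r + #S * q) (fun y => if ∀ i ∈ S, y i = v i then 1 else 0) w ≤
      (#K : ℝ) ^ (r + #S * q) / √(1 + q / #K : ℝ) ^ #S := by
  induction S using Finset.induction_on generalizing w with
  | empty => simp [walkSum_const]
  | insert t S ht ih =>
    obtain ⟨k₀, h1, h2⟩ := hK t
    have := walkSum_mul_latticePaths_le h1 h2
      (ψ := fun y => if ∀ i ∈ S, y i = v i then 1 else 0) (fun w => by split_ifs <;> norm_num)
      (fun w z => by
        congr 1
        refine propext (forall₂_congr fun i hi => ?_)
        rw [Function.update_of_ne (by rintro rfl; exact ht hi)]) ih (v t) q 0 w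
    rw [Finset.card_insert_of_notMem ht, add_mul, one_mul, ← add_assoc]
    convert this using 1
    · congr 1
      funext y
      by_cases hy : y t = v t
      · simp [hy, latticePaths]
      · have : latticePaths 0 (y t - v t) = 0 := by
          unfold latticePaths
          split_ifs with h
          · exact Nat.choose_eq_zero_of_lt (by omega)
          · rfl
        simp [hy, this]
    · simp only [pow_succ, pow_add, Nat.cast_zero, zero_add, pow_zero, mul_one]
      field_simp

end Concentration

section LowerBound

variable {ι : Type*} [Fintype ι] {K : Finset (ι → ℤ)}

theorem walkSum_normSq (hneg : ∀ k ∈ K, -k ∈ K) (hpm : ∀ k ∈ K, ∀ i, k i = 1 ∨ k i = -1)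
    (n : ℕ) (w : ι → ℤ) :
    walkSum K n (fun y => ∑ i, (y i : ℝ) ^ 2) w =
      (#K : ℝ) ^ n * (∑ i, (w i : ℝ) ^ 2 + n * Fintype.card ι) := by
  have hsum : ∀ i, ∑ k ∈ K, (k i : ℝ) = 0 := fun i => by
    have : ∑ k ∈ K, (k i : ℝ) = ∑ k ∈ K, -(k i : ℝ) :=
      Finset.sum_nbij' (fun k => -k) (fun k => -k) hneg hneg (by simp) (by simp) (by simp)
    rw [Finset.sum_neg_distrib] at this
    linarith
  have hsq : ∀ k ∈ K, ∀ i, (k i : ℝ) ^ 2 = 1 := fun k hk i => by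
    rcases hpm k hk i with h | h <;> simp [h]
  have hstep : ∀ w : ι → ℤ, ∑ k ∈ K, ∑ i, ((w + k) i : ℝ) ^ 2 =
      #K * (∑ i, (w i : ℝ) ^ 2 + Fintype.card ι) := fun w => by
    rw [Finset.sum_comm]
    have : ∀ i, ∑ k ∈ K, ((w + k) i : ℝ) ^ 2 = #K * ((w i : ℝ) ^ 2 + 1) := fun i => by
      calc ∑ k ∈ K, ((w + k) i : ℝ) ^ 2
          = ∑ k ∈ K, (((w i : ℝ) ^ 2 + 1) + 2 * w i * k i) := by
            refine Finset.sum_congr rfl fun k hk => ?_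
            rw [← hsq k hk i, Pi.add_apply]; push_cast; ring
        _ = _ := by rw [Finset.sum_add_distrib, ← Finset.mul_sum, hsum]; simp [mul_add]
    simp only [this, ← Finset.mul_sum, Finset.sum_add_distrib]
    simp
  induction n generalizing w with
  | zero => simp [walkSum_zero]
  | succ n ih =>
    rw [walkSum_succ]
    simp only [ih]
    rw [← Finset.mul_sum, Finset.sum_add_distrib, hstep]
    simp
    ring

variable [DecidableEq ι]

theorem le_walkSum_box (hneg : ∀ k ∈ K, -k ∈ K) (hpm : ∀ k ∈ K, ∀ i, k i = 1 ∨ k i = -1)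
    (n L : ℕ) (hL : 2 * n * Fintype.card ι ≤ (L + 1) ^ 2) :
    (#K : ℝ) ^ n / 2 ≤
      walkSum K n (fun y => if y ∈ Fintype.piFinset fun _ => Icc (-L : ℤ) L then 1 else 0) 0 := by
  have hL' : 2 * n * Fintype.card ι ≤ ((L : ℝ) + 1) ^ 2 := by exact_mod_cast hL
  have hpos : (0 : ℝ) < ((L : ℝ) + 1) ^ 2 := by positivity
  calc (#K : ℝ) ^ n / 2
      ≤ (#K : ℝ) ^ n * 1 + (-1 / ((L : ℝ) + 1) ^ 2) * ((#K : ℝ) ^ n * (n * Fintype.card ι)) := by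
        have : n * Fintype.card ι / ((L : ℝ) + 1) ^ 2 ≤ 1 / 2 := by
          rw [div_le_div_iff₀ hpos two_pos]; linarith
        have h2 := mul_le_mul_of_nonneg_left this (pow_nonneg (Nat.cast_nonneg (α := ℝ) #K) n)
        calc _ = (#K : ℝ) ^ n - (#K : ℝ) ^ n * (1 / 2) := by ring
          _ ≤ (#K : ℝ) ^ n - (#K : ℝ) ^ n * (n * Fintype.card ι / ((L : ℝ) + 1) ^ 2) := by
            linarith
          _ = _ := by ring
    _ = walkSum K n (fun y => 1 + (-1 / ((L : ℝ) + 1) ^ 2) * ∑ i, (y i : ℝ) ^ 2) 0 := by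
        rw [walkSum_add_fun, walkSum_const, walkSum_mul_left, walkSum_normSq hneg hpm]
        simp
    _ ≤ _ := by
        refine walkSum_mono _ (fun y => ?_) 0
        have hnn : 0 ≤ ∑ i, (y i : ℝ) ^ 2 := Finset.sum_nonneg fun _ _ => sq_nonneg _
        split_ifs with h
        · have := mul_nonneg (by positivity : 0 ≤ 1 / ((L : ℝ) + 1) ^ 2) hnn
          rw [neg_div, neg_mul]
          linarith
        · simp only [Fintype.mem_piFinset, not_forall, Finset.mem_Icc] at h
          obtain ⟨i, hi⟩ := h
          have h1 : ((L : ℝ) + 1) ^ 2 ≤ (y i : ℝ) ^ 2 := by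
            have : ((L : ℤ) + 1) ^ 2 ≤ y i ^ 2 := by
              rw [sq_le_sq, abs_of_nonneg (by positivity : (0 : ℤ) ≤ (L : ℤ) + 1), le_abs]
              omega
            exact_mod_cast this
          have h2 : (y i : ℝ) ^ 2 ≤ ∑ i, (y i : ℝ) ^ 2 :=
            Finset.single_le_sum (f := fun i => (y i : ℝ) ^ 2) (fun _ _ => sq_nonneg _)
              (Finset.mem_univ i)
          have h3 : 1 ≤ (∑ i, (y i : ℝ) ^ 2) / ((L : ℝ) + 1) ^ 2 := by
            rw [le_div_iff₀ hpos]; linarith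
          have : (-1 / ((L : ℝ) + 1) ^ 2) * ∑ i, (y i : ℝ) ^ 2 =
            - ((∑ i, (y i : ℝ) ^ 2) / ((L : ℝ) + 1) ^ 2) := by ring
          linarith

theorem le_walkSum_return (hneg : ∀ k ∈ K, -k ∈ K) (hpm : ∀ k ∈ K, ∀ i, k i = 1 ∨ k i = -1)
    (k L : ℕ) (hL : 2 * k * Fintype.card ι ≤ (L + 1) ^ 2) :
    (#K : ℝ) ^ (2 * k) / (4 * (2 * L + 1) ^ Fintype.card ι) ≤
      walkSum K (2 * k) (fun y => if y = 0 then 1 else 0) 0 := by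
  set B : Finset (ι → ℤ) := Fintype.piFinset fun _ => Icc (-L : ℤ) L with hB
  set N : (ι → ℤ) → ℝ := fun v => walkSum K k (fun y => if y = v then 1 else 0) 0 with hN
  have hcard : (#B : ℝ) = (2 * L + 1) ^ Fintype.card ι := by
    rw [hB, Fintype.card_piFinset, Finset.prod_const, Finset.card_univ, Int.card_Icc,
      show ((L : ℤ) + 1 - -L).toNat = 2 * L + 1 by omega]
    push_cast; rfl
  have hret : ∀ v, walkSum K k (fun y => if y = 0 then 1 else 0) v = N v := fun v => by
    rw [hN, ← neg_neg v, ← walkSum_neg hneg, ← zero_add (-v), ← walkSum_shift]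
    congr 1
    funext y
    simp [add_neg_eq_zero, eq_comm]
  have hbox : (#K : ℝ) ^ k / 2 ≤ ∑ v ∈ B, N v := by
    refine (le_walkSum_box hneg hpm k L hL).trans_eq ?_
    rw [hN, ← walkSum_sum]
    simp [hB]
  have hlow : ∑ v ∈ B, N v ^ 2 ≤ walkSum K (2 * k) (fun y => if y = 0 then 1 else 0) 0 := by
    rw [two_mul, walkSum_add, funext hret]
    calc ∑ v ∈ B, N v ^ 2
        = walkSum K k (fun y => ∑ v ∈ B, N v * if y = v then 1 else 0) 0 := by
          rw [walkSum_sum]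
          simp only [walkSum_mul_left, sq, hN]
      _ ≤ _ := by
          refine walkSum_mono _ (fun y => ?_) 0
          simp only [mul_ite, mul_one, mul_zero, Finset.sum_ite_eq]
          split_ifs
          · exact le_rfl
          · exact Finset.sum_nonneg fun _ _ => by positivity
  have hcs : (∑ v ∈ B, N v) ^ 2 ≤ #B * ∑ v ∈ B, N v ^ 2 := sq_sum_le_card_mul_sum_sq
  have hpos : (0 : ℝ) < (2 * L + 1) ^ Fintype.card ι := by positivity
  rw [div_le_iff₀ (by positivity)]
  have h1 : ((#K : ℝ) ^ k / 2) ^ 2 ≤ (∑ v ∈ B, N v) ^ 2 := by gcongr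
  rw [hcard] at hcs
  have h2 := mul_le_mul_of_nonneg_left hlow hpos.le
  calc (#K : ℝ) ^ (2 * k) = 4 * ((#K : ℝ) ^ k / 2) ^ 2 := by ring
    _ ≤ 4 * ((2 * L + 1) ^ Fintype.card ι *
        walkSum K (2 * k) (fun y => if y = 0 then 1 else 0) 0) := by linarith
    _ = _ := by ring

end LowerBound

/-- The admissible columns of length `m`. -/
def colSet (m : ℕ) : Finset (Fin m → ℤ) :=
  (Fintype.piFinset fun _ => {1, -1}).filter fun k => |∑ i, k i| ≤ 1

theorem mem_colSet {m : ℕ} {k : Fin m → ℤ} :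
    k ∈ colSet m ↔ (∀ i, k i = 1 ∨ k i = -1) ∧ |∑ i, k i| ≤ 1 := by
  simp [colSet]

theorem neg_mem_colSet {m : ℕ} {k : Fin m → ℤ} (hk : k ∈ colSet m) : -k ∈ colSet m := by
  rw [mem_colSet] at *
  refine ⟨fun i => ?_, by simpa using hk.2⟩
  rcases hk.1 i with h | h <;> simp [h]

theorem abs_le_one_of_mem_colSet {m : ℕ} {k : Fin m → ℤ} (hk : k ∈ colSet m) (i : Fin m) :
    |k i| ≤ 1 := by
  rcases (mem_colSet.mp hk).1 i with h | h <;> simp [h]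

theorem alpha_eq_walkSum (m n : ℕ) :
    (alpha m n : ℝ) =
      walkSum (colSet m) n (fun y => if ∀ i, |y i| ≤ 1 then 1 else 0) 0 := by
  let T : (Fin n → colSet m) → Matrix (Fin m) (Fin n) ℤ := fun x i j => (x j : Fin m → ℤ) i
  have hT : Function.Injective T := fun x y h => by
    funext j
    ext i
    exact congrFun (congrFun h i) j
  have himg : goodA m n =
      T '' (univ.filter fun x : Fin n → colSet m => ∀ i, |∑ j, (x j : Fin m → ℤ) i| ≤ 1 :
        Finset (Fin n → colSet m)) := by
    ext M
    simp only [goodA, Set.mem_ofPred_eq, Set.mem_image, Finset.coe_filter, Finset.mem_univ,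
      true_and]
    constructor
    · rintro ⟨h1, h2, h3⟩
      exact ⟨fun j => ⟨fun i => M i j, mem_colSet.mpr ⟨fun i => h1 i j, h3 j⟩⟩, h2, rfl⟩
    · rintro ⟨x, hx, rfl⟩
      exact ⟨fun i j => (mem_colSet.mp (x j).2).1 i, hx, fun j => (mem_colSet.mp (x j).2).2⟩
  rw [alpha, himg, Set.ncard_image_of_injective _ hT, Set.ncard_coe_finset, walkSum,
    Finset.card_filter]
  simp

theorem alpha_one (m : ℕ) : alpha m 1 = #(colSet m) := by
  have h := alpha_eq_walkSum m 1
  rw [walkSum_succ, Finset.sum_congr rfl (g := fun _ => (1 : ℝ))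
    (fun k hk => by simp [walkSum_zero, abs_le_one_of_mem_colSet hk])] at h
  simpa using h

theorem even_sum_sub_card {m : ℕ} {k : Fin m → ℤ} (hk : ∀ i, k i = 1 ∨ k i = -1) :
    (2 : ℤ) ∣ ∑ i, k i - m := by
  have : ∑ i, k i - m = ∑ i, (k i - 1) := by simp
  rw [this]
  refine Finset.dvd_sum fun i _ => ?_
  rcases hk i with h | h <;> simp [h]

theorem sum_eq_zero_of_mem_colSet {m : ℕ} (hm : Even m) {k : Fin m → ℤ} (hk : k ∈ colSet m) :
    ∑ i, k i = 0 := by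
  rw [mem_colSet] at hk
  have h1 := even_sum_sub_card hk.1
  have h2 := abs_le.mp hk.2
  obtain ⟨r, rfl⟩ := hm
  push_cast at h1
  omega

/-- Appending the entry that makes the column sum vanish. -/
def colSetEquiv (e : ℕ) : colSet (2 * e + 1) ≃ colSet (2 * e + 2) where
  toFun k := ⟨Fin.snoc (α := fun _ => ℤ) k.1 (-∑ i, k.1 i), by
    obtain ⟨k, hk⟩ := k
    rw [mem_colSet] at hk ⊢
    refine ⟨fun i => ?_, ?_⟩
    · refine Fin.lastCases ?_ (fun i => ?_) i
      · have h1 := even_sum_sub_card hk.1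
        have h2 := abs_le.mp hk.2
        rw [Fin.snoc_last]
        push_cast at h1
        dsimp only
        omega
      · rw [Fin.snoc_castSucc]
        exact hk.1 i
    · rw [Fin.sum_univ_castSucc]
      simp⟩
  invFun k := ⟨fun i => k.1 i.castSucc, by
    obtain ⟨k, hk⟩ := k
    have h0 := sum_eq_zero_of_mem_colSet (by simp [parity_simps]) hk
    rw [mem_colSet] at hk ⊢
    refine ⟨fun i => hk.1 _, ?_⟩
    rw [Fin.sum_univ_castSucc] at h0
    rw [eq_neg_of_add_eq_zero_left h0, abs_neg]
    rcases hk.1 (Fin.last _) with h | h <;> simp [h]⟩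
  left_inv k := by simp
  right_inv k := by
    ext i
    refine Fin.lastCases ?_ (fun i => ?_) i
    · have h0 := sum_eq_zero_of_mem_colSet (by simp [parity_simps]) k.2
      rw [Fin.sum_univ_castSucc] at h0
      simp only [Fin.snoc_last]
      linarith
    · simp

theorem card_colSet_even (e : ℕ) : #(colSet (2 * e)) = (2 * e).choose e := by
  have hs : ∀ s : Finset (Fin (2 * e)),
      ∑ i, (if i ∈ s then (1 : ℤ) else -1) = 2 * #s - 2 * e := fun s => by
    have : ∀ i, (if i ∈ s then (1 : ℤ) else -1) = 2 * (if i ∈ s then 1 else 0) - 1 := fun i => by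
      split_ifs <;> norm_num
    simp [this, mul_comm]
  have hk : ∀ k : Fin (2 * e) → ℤ, (∀ i, k i = 1 ∨ k i = -1) →
      (fun i => if i ∈ univ.filter (fun i => k i = 1) then (1 : ℤ) else -1) = k := fun k hk => by
    funext i
    rcases hk i with h | h <;> simp [h]
  rw [← Finset.card_fin (2 * e), ← Finset.card_powersetCard, Finset.card_fin]
  refine Finset.card_nbij' (fun k => univ.filter fun i => k i = 1)
    (fun s i => if i ∈ s then 1 else -1) (fun k hkm => ?_) (fun s hsm => ?_) (fun k hkm => ?_)
    (fun s _ => ?_)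
  · have h0 := sum_eq_zero_of_mem_colSet (even_two_mul e) hkm
    rw [← hk k (mem_colSet.mp hkm).1, hs] at h0
    simp only [Finset.mem_coe, Finset.mem_powersetCard_univ]
    omega
  · simp only [Finset.mem_coe, Finset.mem_powersetCard_univ] at hsm
    rw [Finset.mem_coe, mem_colSet, hs, hsm]
    exact ⟨fun i => by by_cases h : i ∈ s <;> simp [h], by simp⟩
  · exact hk k (mem_colSet.mp hkm).1
  · ext i; simp

theorem card_colSet_odd (e : ℕ) : #(colSet (2 * e + 1)) = #(colSet (2 * e + 2)) := by
  simpa using Fintype.card_congr (colSetEquiv e)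

theorem exists_update_mem_colSet (e : ℕ) (t : Fin (2 * e + 1)) :
    ∃ k₀ : Fin (2 * e + 1) → ℤ, Function.update k₀ t 1 ∈ colSet (2 * e + 1) ∧
      Function.update k₀ t (-1) ∈ colSet (2 * e + 1) := by
  have h : ∀ z : ℤ, z = 1 ∨ z = -1 →
      t.insertNth (α := fun _ => ℤ) z (fun i => (-1) ^ (i : ℕ)) ∈ colSet (2 * e + 1) := by
    intro z hz
    rw [mem_colSet]
    refine ⟨fun i => ?_, ?_⟩
    · refine Fin.succAboveCases t ?_ (fun i => ?_) i
      · simpa using hz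
      · simpa using neg_one_pow_eq_or ℤ (i : ℕ)
    · rw [Fin.sum_univ_succAbove _ t]
      simp only [Fin.insertNth_apply_same, Fin.insertNth_apply_succAbove, Fin.sum_neg_one_pow]
      rcases hz with rfl | rfl <;> simp
  refine ⟨t.insertNth (α := fun _ => ℤ) 0 (fun i => (-1) ^ (i : ℕ)), ?_, ?_⟩
  · rw [Fin.update_insertNth]; exact h _ (Or.inl rfl)
  · rw [Fin.update_insertNth]; exact h _ (Or.inr rfl)

theorem alpha_even_eq_walkSum (e n : ℕ) :
    (alpha (2 * e + 2) n : ℝ) = walkSum (colSet (2 * e + 1)) n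
      (fun y => if (∀ i, |y i| ≤ 1) ∧ |∑ i, y i| ≤ 1 then 1 else 0) 0 := by
  rw [alpha_eq_walkSum, walkSum, walkSum,
    ← (Equiv.arrowCongr (Equiv.refl (Fin n)) (colSetEquiv e)).sum_comp]
  refine Finset.sum_congr rfl fun x _ => ?_
  congr 1
  rw [Fin.forall_fin_succ']
  simp [colSetEquiv, Finset.sum_comm (s := (univ : Finset (Fin n)))]

theorem walkSum_colSet_le {d : ℕ} (hd : 0 < d)
    (hK : ∀ t, ∃ k₀ : Fin d → ℤ,
      Function.update k₀ t 1 ∈ colSet d ∧ Function.update k₀ t (-1) ∈ colSet d)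
    {G : (Fin d → ℤ) → ℝ}
    (hG : ∀ y, G y ≤ if ∀ i, |y i| ≤ 1 then 1 else 0) :
    ∃ C : ℝ, 0 < C ∧ ∀ n : ℕ, 1 ≤ n → walkSum (colSet d) n G 0 ≤
      C * (#(colSet d) : ℝ) ^ n / √n ^ d := by
  set K := colSet d
  have hK0 : 1 ≤ #K := by
    obtain ⟨k, hk, -⟩ := hK ⟨0, hd⟩
    exact Finset.card_pos.mpr ⟨_, hk⟩
  have hκ : (1 : ℝ) ≤ #K := by exact_mod_cast hK0
  have hd0 : (0 : ℝ) < d := by positivity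
  refine ⟨3 ^ d * √(d * #K) ^ d, by positivity, fun n hn => ?_⟩
  have hn0 : (0 : ℝ) < n := by exact_mod_cast hn
  have hq : √n / √(d * #K) ≤ √(1 + (n / d : ℕ) / #K : ℝ) := by
    rw [← Real.sqrt_div' _ (by positivity)]
    apply Real.sqrt_le_sqrt
    have h1 : n ≤ d * (n / d + 1) := by
      have := Nat.div_add_mod n d
      have := Nat.mod_lt n (hd)
      rw [mul_add]; omega
    have h2 : (n : ℝ) ≤ d * ((n / d : ℕ) + 1) := by exact_mod_cast h1
    rw [div_le_iff₀ (by positivity)]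
    calc (n : ℝ) ≤ d * ((n / d : ℕ) + 1) := h2
      _ ≤ d * ((n / d : ℕ) + #K) := by gcongr
      _ = _ := by field_simp; ring
  have hpt : ∀ v, walkSum K n (fun y => if y = v then 1 else 0) 0 ≤
      (#K : ℝ) ^ n / (√n / √(d * #K)) ^ d := fun v => by
    have h := walkSum_indicator_le hK (n / d) (n % d) v univ 0
    rw [Finset.card_fin, Nat.mod_add_div] at h
    simp only [Finset.mem_univ, forall_const, ← funext_iff] at h
    refine h.trans ?_
    gcongr
  calc walkSum K n G 0
      ≤ walkSum K n (fun y => ∑ v ∈ Fintype.piFinset fun _ : Fin d => Icc (-1 : ℤ) 1,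
          if y = v then 1 else 0) 0 := by
        refine walkSum_mono _ (fun y => (hG y).trans_eq ?_) 0
        simp [abs_le]
    _ ≤ ∑ v ∈ Fintype.piFinset fun _ : Fin d => Icc (-1 : ℤ) 1,
          (#K : ℝ) ^ n / (√n / √(d * #K)) ^ d := by
        rw [walkSum_sum]
        exact Finset.sum_le_sum fun v _ => hpt v
    _ = _ := by
        rw [Finset.sum_const, Fintype.card_piFinset, nsmul_eq_mul]
        simp [div_pow]
        field_simp

theorem le_walkSum_colSet {d : ℕ} (hd : 0 < d) {G : (Fin d → ℤ) → ℝ}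
    (h0 : ∀ y, (if y = 0 then 1 else 0) ≤ G y) (h1 : ∀ k ∈ colSet d, G k = 1) :
    ∃ c : ℝ, 0 < c ∧ ∀ n : ℕ, 2 ≤ n →
      c * (#(colSet d) : ℝ) ^ n / √n ^ d ≤
        walkSum (colSet d) n G 0 := by
  set K := colSet d
  have hneg : ∀ k ∈ K, -k ∈ K := fun k hk => neg_mem_colSet hk
  have hpm : ∀ k ∈ K, ∀ i, k i = 1 ∨ k i = -1 := fun k hk => (mem_colSet.mp hk).1
  have hdpos : (0 : ℝ) < d := by positivity
  have key : ∀ k n : ℕ, 1 ≤ k → 2 * k ≤ n →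
      1 / (4 * (3 * √d) ^ d) * (#K : ℝ) ^ (2 * k) / √n ^ d ≤
        walkSum K (2 * k) (fun y => if y = 0 then 1 else 0) 0 := fun k n hk hkn => by
    have hL := Nat.sqrt_lt' (m := 2 * k * d) (n := Nat.sqrt (2 * k * d) + 1)
    refine le_trans ?_ (le_walkSum_return hneg hpm k (Nat.sqrt (2 * k * d)) ?_)
    · have hL1 : (Nat.sqrt (2 * k * d) : ℝ) ≤ √d * √n := by
        rw [← Real.sqrt_mul hdpos.le]
        refine Real.nat_sqrt_le_real_sqrt.trans (Real.sqrt_le_sqrt ?_)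
        have : 2 * k * d ≤ d * n := by rw [mul_comm]; gcongr
        exact_mod_cast this
      have hL2 : 1 ≤ √(d : ℝ) * √n := by
        rw [← Real.sqrt_mul hdpos.le, Real.one_le_sqrt]
        exact_mod_cast Nat.mul_pos hd (by omega : 0 < n)
      have hnpos : (0 : ℝ) < n := by exact_mod_cast (by omega : 0 < n)
      calc _ = (#K : ℝ) ^ (2 * k) / (4 * (3 * (√d * √n)) ^ d) := by
            rw [mul_pow, mul_pow, mul_pow]; field_simp
        _ ≤ _ := by
            rw [Fintype.card_fin]
            gcongr
            linarith
    · rw [Fintype.card_fin]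
      exact (hL.mp (Nat.lt_succ_self _)).le
  refine ⟨1 / (4 * (3 * √d) ^ d), by positivity, fun n hn => ?_⟩
  obtain ⟨k, rfl | rfl⟩ := n.even_or_odd'
  · exact (key k _ (by omega) le_rfl).trans (walkSum_mono _ h0 0)
  · calc _ = #K * (1 / (4 * (3 * √d) ^ d) * (#K : ℝ) ^ (2 * k) /
            √((2 * k + 1 : ℕ) : ℝ) ^ d) := by ring
      _ ≤ #K * walkSum K (2 * k) (fun y => if y = 0 then 1 else 0) 0 := by
          gcongr
          exact key k _ (by omega) (by omega)
      _ ≤ _ := by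
          rw [walkSum_succ', ← walkSum_mul_left]
          refine walkSum_mono _ (fun y => ?_) 0
          have hG0 : ∀ y, 0 ≤ G y := fun y => le_trans (by split_ifs <;> norm_num) (h0 y)
          split_ifs with hy
          · subst hy
            simp [Finset.sum_congr rfl h1]
          · simpa using Finset.sum_nonneg fun k _ => hG0 (y + k)

theorem rpow_add_half_eq_sqrt_pow (e n : ℕ) :
    (n : ℝ) ^ ((e : ℝ) + 1 / 2) = √n ^ (2 * e + 1) := by
  rw [Real.sqrt_eq_rpow, ← Real.rpow_natCast, ← Real.rpow_mul (Nat.cast_nonneg n)]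
  congr 1
  push_cast
  ring

theorem exists_alpha_eq_walkSum (m : ℕ) (hm : 0 < m) :
    ∃ G : (Fin (2 * ((m - 1) / 2) + 1) → ℤ) → ℝ,
      (∀ y, G y ≤ if ∀ i, |y i| ≤ 1 then 1 else 0) ∧ (∀ y, (if y = 0 then 1 else 0) ≤ G y) ∧
      (∀ k ∈ colSet (2 * ((m - 1) / 2) + 1), G k = 1) ∧
      ∀ n, (alpha m n : ℝ) = walkSum (colSet (2 * ((m - 1) / 2) + 1)) n G 0 := by
  generalize he : (m - 1) / 2 = e
  obtain rfl | rfl : m = 2 * e + 1 ∨ m = 2 * e + 2 := by omega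
  · refine ⟨_, fun y => le_rfl, fun y => ?_, fun k hk => ?_, alpha_eq_walkSum _⟩
    · rcases eq_or_ne y 0 with rfl | hy
      · simp
      · rw [if_neg hy]; positivity
    · exact if_pos (abs_le_one_of_mem_colSet hk)
  · refine ⟨_, fun y => ?_, fun y => ?_, fun k hk => ?_, alpha_even_eq_walkSum e⟩
    · split_ifs <;> simp_all
    · rcases eq_or_ne y 0 with rfl | hy
      · simp
      · rw [if_neg hy]; positivity
    · exact if_pos ⟨abs_le_one_of_mem_colSet hk, (mem_colSet.mp hk).2⟩

theorem card_colSet (m : ℕ) (hm : 0 < m) :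
    #(colSet m) = (2 * ((m + 1) / 2)).choose ((m + 1) / 2) := by
  obtain ⟨e, rfl | rfl⟩ := m.even_or_odd'
  · rw [card_colSet_even, show (2 * e + 1) / 2 = e by omega]
  · rw [card_colSet_odd, show (2 * e + 1 + 1) / 2 = e + 1 by omega,
      show 2 * e + 2 = 2 * (e + 1) by ring, card_colSet_even]

theorem stmt19 (m : ℕ) (hm : 0 < m) :
    alpha m 1 = Nat.choose (2 * ((m + 1) / 2)) ((m + 1) / 2) ∧
    ∃ c C : ℝ, 0 < c ∧ 0 < C ∧ ∃ N : ℕ, ∀ n ≥ N,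
      c * (alpha m 1 : ℝ) ^ n / (n : ℝ) ^ ((((m - 1) / 2 : ℕ) : ℝ) + 1 / 2) ≤ (alpha m n : ℝ) ∧
      (alpha m n : ℝ) ≤ C * (alpha m 1 : ℝ) ^ n / (n : ℝ) ^ ((((m - 1) / 2 : ℕ) : ℝ) + 1 / 2) := by
  refine ⟨by rw [alpha_one, card_colSet m hm], ?_⟩
  obtain ⟨G, hG, h0, h1, h⟩ := exists_alpha_eq_walkSum m hm
  obtain ⟨C, hC, hupper⟩ := walkSum_colSet_le (Nat.succ_pos _) (exists_update_mem_colSet _) hG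
  obtain ⟨c, hc, hlower⟩ := le_walkSum_colSet (Nat.succ_pos _) h0 h1
  have hcard : alpha m 1 = #(colSet (2 * ((m - 1) / 2) + 1)) := by
    rw [alpha_one, card_colSet m hm, card_colSet _ (Nat.succ_pos _),
      show (2 * ((m - 1) / 2) + 1 + 1) / 2 = (m + 1) / 2 by omega]
  refine ⟨c, C, hc, hC, 2, fun n hn => ?_⟩
  rw [rpow_add_half_eq_sqrt_pow, hcard, h]
  exact ⟨hlower n hn, hupper n (by omega)⟩
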